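/- Fix λ > 0. The variance of the mixed fractional Poisson process satisfies lim_{t→∞} t^{−2α₂} Var_N(t) = (λ²/C₂²) (2/Γ(2α₂+1) − 1/Γ(α₂+1)²). -/

import Mathlib

open Real MeasureTheory Filter Topology

/-- Two-parameter Mittag-Leffler function `E_{a,b}(x)`. -/
noncomputable def ML (a b x : ℝ) : ℝ :=
  ∑' k : ℕ, x ^ k / Real.Gamma ((k : ℝ) * a + b)

/-- Second-order (three-parameter, `γ = 2`) Mittag-Leffler function `E²_{a,b}(x)`. -/
noncomputable def ML2 (a b x : ℝ) : ℝ :=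
  ∑' k : ℕ, ((k : ℝ) + 1) * x ^ k / Real.Gamma ((k : ℝ) * a + b)

/-- Renewal function `U(t)` of the inverse mixed stable subordinator. -/
noncomputable def Ufun (a1 a2 C1 C2 t : ℝ) : ℝ :=
  t ^ a1 / C1 * ML (a1 - a2) (a1 + 1) (-C2 * t ^ (a1 - a2) / C1)

/-- Renewal density `u(t)` of the inverse mixed stable subordinator. -/
noncomputable def ufun (a1 a2 C1 C2 t : ℝ) : ℝ :=
  t ^ (a1 - 1) / C1 * ML (a1 - a2) a1 (-C2 * t ^ (a1 - a2) / C1)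

/-- Covariance function of the inverse mixed stable subordinator. -/
noncomputable def CovY (a1 a2 C1 C2 s t : ℝ) : ℝ :=
  (∫ τ in (0:ℝ)..(min s t),
      (Ufun a1 a2 C1 C2 (s - τ) + Ufun a1 a2 C1 C2 (t - τ)) * ufun a1 a2 C1 C2 τ)
    - Ufun a1 a2 C1 C2 s * Ufun a1 a2 C1 C2 t

/-- Variance function of the inverse mixed stable subordinator. -/
noncomputable def VarY (a1 a2 C1 C2 t : ℝ) : ℝ := CovY a1 a2 C1 C2 t t

/-- The integral `I(s,t) = ∫₀^s U(t-τ) u(τ) dτ`. -/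
noncomputable def Ifun (a1 a2 C1 C2 s t : ℝ) : ℝ :=
  ∫ τ in (0:ℝ)..s, Ufun a1 a2 C1 C2 (t - τ) * ufun a1 a2 C1 C2 τ

/-- The constant `K(s)`. -/
noncomputable def Kfun (a1 a2 C1 C2 s : ℝ) : ℝ :=
  s ^ (a1 + 1) / (C1 * C2 * Real.Gamma a2) *
    ∑' k : ℕ, ((k : ℝ) * (a1 - a2) + a1) * (-C2 * s ^ (a1 - a2) / C1) ^ k /
      Real.Gamma ((k : ℝ) * (a1 - a2) + a1 + 2)

/-- Covariance function of the mixed fractional Poisson process. -/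
noncomputable def CovN (a1 a2 C1 C2 lam s t : ℝ) : ℝ :=
  lam * Ufun a1 a2 C1 C2 (min s t) + lam ^ 2 * CovY a1 a2 C1 C2 s t

/-- Variance function of the mixed fractional Poisson process. -/
noncomputable def VarN (a1 a2 C1 C2 lam t : ℝ) : ℝ :=
  lam * Ufun a1 a2 C1 C2 t + lam ^ 2 * VarY a1 a2 C1 C2 t

/-- Correlation function of the inverse mixed stable subordinator. -/
noncomputable def CorrY (a1 a2 C1 C2 s t : ℝ) : ℝ :=
  CovY a1 a2 C1 C2 s t /
    (Real.sqrt (VarY a1 a2 C1 C2 s) * Real.sqrt (VarY a1 a2 C1 C2 t))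

/-- Correlation function of the mixed fractional Poisson process. -/
noncomputable def CorrN (a1 a2 C1 C2 lam s t : ℝ) : ℝ :=
  CovN a1 a2 C1 C2 lam s t /
    (Real.sqrt (VarN a1 a2 C1 C2 lam s) * Real.sqrt (VarN a1 a2 C1 C2 lam t))

/-- Covariance function of the mixed fractional Poissonian noise. -/
noncomputable def CovZ (a1 a2 C1 C2 lam δ s t : ℝ) : ℝ :=
  CovN a1 a2 C1 C2 lam (s + δ) (t + δ) + CovN a1 a2 C1 C2 lam s t
    - CovN a1 a2 C1 C2 lam (s + δ) t - CovN a1 a2 C1 C2 lam s (t + δ)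

/-- Variance function of the mixed fractional Poissonian noise. -/
noncomputable def VarZ (a1 a2 C1 C2 lam δ t : ℝ) : ℝ := CovZ a1 a2 C1 C2 lam δ t t

/-- Correlation function of the mixed fractional Poissonian noise. -/
noncomputable def CorrZ (a1 a2 C1 C2 lam δ s t : ℝ) : ℝ :=
  CovZ a1 a2 C1 C2 lam δ s t /
    (Real.sqrt (VarZ a1 a2 C1 C2 lam δ s) * Real.sqrt (VarZ a1 a2 C1 C2 lam δ t))

/-- Incomplete Beta function `B(a, b; x)`. -/
noncomputable def Binc (a b x : ℝ) : ℝ :=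
  ∫ y in (0:ℝ)..x, y ^ (a - 1) * (1 - y) ^ (b - 1)

theorem integrableOn_rpow_mul_cexp_neg {s : ℝ} (hs : -1 < s) {r : ℂ} (hr : 0 < r.re) :
    IntegrableOn (fun t : ℝ => ((t ^ s : ℝ) : ℂ) * Complex.exp (-(r * t))) (Set.Ioi 0) := by
  refine Integrable.mono' (integrableOn_rpow_mul_exp_neg_mul_rpow hs one_pos hr) ?_ ?_
  · exact Measurable.aestronglyMeasurable (by fun_prop)
  · filter_upwards [ae_restrict_mem measurableSet_Ioi] with t ht
    have ht : 0 < t := ht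
    rw [norm_mul, Complex.norm_exp, Complex.norm_real, Real.norm_of_nonneg (by positivity)]
    simp

theorem hasDerivAt_integral_rpow_mul_cexp_neg {s : ℝ} (hs : -1 < s) {r : ℂ} (hr : 0 < r.re) :
    HasDerivAt (fun r : ℂ => ∫ t in Set.Ioi (0 : ℝ), ((t ^ s : ℝ) : ℂ) * Complex.exp (-(r * t)))
      (∫ t in Set.Ioi (0 : ℝ), -((t ^ (s + 1) : ℝ) : ℂ) * Complex.exp (-(r * t))) r := by
  refine (hasDerivAt_integral_of_dominated_loc_of_deriv_le
    (μ := volume.restrict (Set.Ioi (0 : ℝ)))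
    (F := fun r t => ((t ^ s : ℝ) : ℂ) * Complex.exp (-(r * t)))
    (s := {z : ℂ | r.re / 2 < z.re}) (bound := fun t => t ^ (s + 1) * rexp (-(r.re / 2) * t ^ (1 : ℝ)))
    (F' := fun r t => -((t ^ (s + 1) : ℝ) : ℂ) * Complex.exp (-(r * t)))
    ((isOpen_lt continuous_const Complex.continuous_re).mem_nhds (by simpa using hr))
    ?_ (integrableOn_rpow_mul_cexp_neg hs hr) ?_ ?_
    (integrableOn_rpow_mul_exp_neg_mul_rpow (by linarith) one_pos (by linarith)) ?_).2
  · exact Eventually.of_forall fun z => Measurable.aestronglyMeasurable (by fun_prop)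
  · exact Measurable.aestronglyMeasurable (by fun_prop)
  · filter_upwards [ae_restrict_mem measurableSet_Ioi] with t ht z hz
    have ht : 0 < t := ht
    have hz : r.re / 2 < z.re := hz
    rw [norm_mul, Complex.norm_exp, norm_neg, Complex.norm_real, Real.norm_of_nonneg (by positivity)]
    simp only [Complex.neg_re, Complex.mul_re, Complex.ofReal_re, Complex.ofReal_im, mul_zero,
      sub_zero, rpow_one]
    gcongr
    nlinarith
  · filter_upwards [ae_restrict_mem measurableSet_Ioi] with t ht z hz
    have ht : 0 < t := ht
    have h : HasDerivAt (fun z : ℂ => -(z * (t : ℂ))) (-(1 * (t : ℂ))) z :=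
      ((hasDerivAt_id z).mul_const (t : ℂ)).neg
    convert! (h.cexp.const_mul ((t ^ s : ℝ) : ℂ)) using 1
    rw [rpow_add_one ht.ne']
    push_cast
    ring

/-- The Laplace transform of a real power, on the right half-plane. -/
theorem integral_rpow_mul_cexp_neg {s : ℝ} (hs : -1 < s) {r : ℂ} (hr : 0 < r.re) :
    ∫ t in Set.Ioi (0 : ℝ), ((t ^ s : ℝ) : ℂ) * Complex.exp (-(r * t)) =
      r ^ (-(s + 1) : ℂ) * (Real.Gamma (s + 1) : ℂ) := by
  have hopen : IsOpen {z : ℂ | 0 < z.re} := isOpen_lt continuous_const Complex.continuous_re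
  have hpre : IsPreconnected {z : ℂ | 0 < z.re} := (convex_halfSpace_re_gt 0).isPreconnected
  refine AnalyticOnNhd.eqOn_of_preconnected_of_frequently_eq
    (f := fun r : ℂ => ∫ t in Set.Ioi (0 : ℝ), ((t ^ s : ℝ) : ℂ) * Complex.exp (-(r * t)))
    (g := fun r : ℂ => r ^ (-(s + 1) : ℂ) * (Real.Gamma (s + 1) : ℂ))
    (DifferentiableOn.analyticOnNhd (fun z hz =>
      (hasDerivAt_integral_rpow_mul_cexp_neg hs hz).differentiableAt.differentiableWithinAt) hopen)
    (DifferentiableOn.analyticOnNhd (fun z hz => ?_) hopen) hpre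
    (show (1 : ℂ) ∈ {z : ℂ | 0 < z.re} by simp) ?_ hr
  · refine DifferentiableAt.differentiableWithinAt (DifferentiableAt.mul_const ?_ _)
    exact differentiableAt_id.cpow_const (Or.inl hz)
  · have hreal : ∀ x : ℝ, 0 < x →
        ∫ t in Set.Ioi (0 : ℝ), ((t ^ s : ℝ) : ℂ) * Complex.exp (-((x : ℂ) * t)) =
          (x : ℂ) ^ (-(s + 1) : ℂ) * (Real.Gamma (s + 1) : ℂ) := by
      intro x hx
      have h := Real.integral_rpow_mul_exp_neg_mul_Ioi (a := s + 1) (by linarith) hx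
      rw [add_sub_cancel_right, one_div, inv_rpow hx.le, ← rpow_neg hx.le] at h
      have h' := congrArg (fun y : ℝ => (y : ℂ)) h
      simp only [Complex.ofReal_mul, Complex.ofReal_cpow hx.le] at h'
      rw [← integral_complex_ofReal] at h'
      push_cast at h' ⊢
      exact h'
    have htend : Tendsto (fun x : ℝ => (x : ℂ)) (𝓝[≠] 1) (𝓝[≠] (1 : ℂ)) := by
      refine tendsto_nhdsWithin_iff.mpr ⟨?_, ?_⟩
      · exact (Complex.continuous_ofReal.tendsto' 1 1 (by simp)).mono_left nhdsWithin_le_nhds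
      · filter_upwards [self_mem_nhdsWithin] with x hx
        simpa using hx
    refine htend.frequently (Eventually.frequently ?_)
    filter_upwards [mem_nhdsWithin_of_mem_nhds (lt_mem_nhds (zero_lt_one' ℝ))] with x hx
    exact hreal x hx

/-- The parametrisation of the vertical line `Re = 1` by frequency. -/
noncomputable def vline (w : ℝ) : ℂ := 1 + 2 * π * w * Complex.I

@[simp] theorem vline_re (w : ℝ) : (vline w).re = 1 := by simp [vline]

theorem vline_im (w : ℝ) : (vline w).im = 2 * π * w := by simp [vline]

@[fun_prop] theorem continuous_vline : Continuous vline := by unfold vline; fun_prop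

theorem vline_ne_zero (w : ℝ) : vline w ≠ 0 := fun h => by
  have := vline_re w
  simp [h] at this

theorem vline_mem_slitPlane (w : ℝ) : vline w ∈ Complex.slitPlane := Or.inl (by simp)

theorem one_le_norm_vline (w : ℝ) : 1 ≤ ‖vline w‖ := by
  simpa using Complex.abs_re_le_norm (vline w)

theorem continuous_vline_cpow (a : ℂ) : Continuous fun w => vline w ^ a :=
  continuous_vline.cpow continuous_const vline_mem_slitPlane

theorem integrable_vline_cpow {s : ℝ} (hs : 0 < s) :
    Integrable fun w : ℝ => vline w ^ (-(s + 1) : ℂ) := by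
  have h := (integrable_rpow_neg_one_add_norm_sq (E := ℝ) (μ := volume) (r := s + 1)
    (by simpa using hs)).comp_mul_left' (R := 2 * π) (by positivity)
  refine h.mono' (continuous_vline_cpow _).aestronglyMeasurable (Eventually.of_forall fun w => ?_)
  have e : (-(s + 1) : ℂ) = ((-(s + 1) : ℝ) : ℂ) := by push_cast; ring
  rw [e, Complex.norm_cpow_real, Complex.norm_def, Complex.normSq_apply, vline_re, vline_im,
    Real.sqrt_eq_rpow, ← rpow_mul (by nlinarith [sq_nonneg (2 * π * w)]), norm_eq_abs, sq_abs]
  apply le_of_eq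
  ring_nf

/-- The Bromwich inversion formula for the reciprocal Gamma function. -/
theorem integral_cexp_mul_vline_cpow {s : ℝ} (hs : 0 < s) :
    ∫ w : ℝ, Complex.exp (vline w) * vline w ^ (-(s + 1) : ℂ) = ((Real.Gamma (s + 1))⁻¹ : ℝ) := by
  have hΓ : (Real.Gamma (s + 1) : ℂ) ≠ 0 :=
    Complex.ofReal_ne_zero.mpr (Real.Gamma_pos_of_pos (by linarith)).ne'
  set g : ℝ → ℂ := fun t => ((t ^ s : ℝ) : ℂ) * Complex.exp (-(1 * t)) with hg
  set f : ℝ → ℂ := (Set.Ioi 0).indicator g with hf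
  have hfi : Integrable f :=
    (integrable_indicator_iff measurableSet_Ioi).mpr
      (integrableOn_rpow_mul_cexp_neg (by linarith) (by simp))
  have hF : FourierTransform.fourier f =
      fun w => vline w ^ (-(s + 1) : ℂ) * (Real.Gamma (s + 1) : ℂ) := by
    ext w
    rw [Real.fourier_real_eq_integral_exp_smul,
      ← integral_rpow_mul_cexp_neg (r := vline w) (by linarith) (by simp),
      ← integral_indicator measurableSet_Ioi]
    congr 1 with t
    by_cases ht : t ∈ Set.Ioi (0 : ℝ)
    · simp only [hf, hg, Set.indicator_of_mem ht, smul_eq_mul]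
      rw [mul_left_comm, ← Complex.exp_add]
      congr 2
      simp only [vline]
      push_cast
      ring
    · simp [hf, Set.indicator_of_notMem ht]
  have hFi : Integrable (FourierTransform.fourier f) := by
    rw [hF]
    exact (integrable_vline_cpow hs).mul_const _
  have hc : ContinuousAt f 1 := by
    have : g =ᶠ[𝓝 1] f := by
      filter_upwards [lt_mem_nhds (zero_lt_one' ℝ)] with t ht
      simp [hf, Set.indicator_of_mem (show t ∈ Set.Ioi (0 : ℝ) from ht)]
    refine ContinuousAt.congr ?_ this
    have h1 : ContinuousAt (fun t : ℝ => t ^ s) 1 :=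
      Real.continuousAt_rpow_const _ _ (Or.inl one_ne_zero)
    exact (Complex.continuous_ofReal.continuousAt.comp h1).mul (by fun_prop)
  have h := hfi.fourierInv_fourier_eq hFi hc
  rw [Real.fourierInv_eq', hF] at h
  have h1 : f 1 = Complex.exp (-1) := by simp [hf, hg]
  rw [h1] at h
  have key : ∫ w : ℝ, Complex.exp (vline w) * vline w ^ (-(s + 1) : ℂ) =
      Complex.exp 1 * (∫ v : ℝ, Complex.exp (((2 * π * inner ℝ v 1 : ℝ) : ℂ) * Complex.I) •
        (vline v ^ (-(s + 1) : ℂ) * (Real.Gamma (s + 1) : ℂ))) * (Real.Gamma (s + 1) : ℂ)⁻¹ := by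
    rw [← integral_const_mul, ← integral_mul_const]
    congr 1 with w
    have : Complex.exp (vline w) =
        Complex.exp 1 * Complex.exp (((2 * π * inner ℝ w 1 : ℝ) : ℂ) * Complex.I) := by
      rw [← Complex.exp_add]
      simp [vline]
    rw [this, smul_eq_mul]
    field_simp
  rw [key, h, ← Complex.exp_add]
  simp

/-- The two-parameter Mittag-Leffler function of a complex variable. -/
noncomputable def complexML (a b : ℝ) (z : ℂ) : ℂ :=
  ∑' k : ℕ, z ^ k / (Real.Gamma ((k : ℝ) * a + b) : ℂ)

theorem complexML_ofReal (a b x : ℝ) : complexML a b (x : ℂ) = (ML a b x : ℂ) := by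
  simp [complexML, ML, Complex.ofReal_tsum]

theorem rpow_mul_exp_neg_le_Gamma {A s : ℝ} (hA : 0 < A) (hs : 1 ≤ s) :
    A ^ (s - 1) * rexp (-A) ≤ Real.Gamma s := by
  have hs0 : 0 < s := by linarith
  have hsub : Set.Ioi A ⊆ Set.Ioi (0 : ℝ) := Set.Ioi_subset_Ioi hA.le
  rw [Real.Gamma_eq_integral hs0, ← integral_exp_neg_Ioi, ← integral_const_mul]
  calc ∫ x in Set.Ioi A, A ^ (s - 1) * rexp (-x)
      ≤ ∫ x in Set.Ioi A, rexp (-x) * x ^ (s - 1) := by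
        refine setIntegral_mono_on ((integrableOn_exp_neg_Ioi A).const_mul _)
          ((Real.GammaIntegral_convergent hs0).mono_set hsub) measurableSet_Ioi fun x hx => ?_
        have hx : A < x := hx
        rw [mul_comm]
        gcongr
    _ ≤ ∫ x in Set.Ioi 0, rexp (-x) * x ^ (s - 1) := by
        refine setIntegral_mono_set (Real.GammaIntegral_convergent hs0) ?_ hsub.eventuallyLE
        filter_upwards [ae_restrict_mem measurableSet_Ioi] with x hx
        have hx : 0 < x := hx
        simp only [Pi.zero_apply]
        positivity

theorem summable_pow_div_Gamma {a b : ℝ} (ha : 0 < a) (hb : 0 < b) {R : ℝ} (hR : 0 ≤ R) :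
    Summable fun k : ℕ => R ^ k / Real.Gamma ((k : ℝ) * a + b) := by
  set A : ℝ := (2 * (R + 1)) ^ a⁻¹ with hA
  have hA0 : 0 < A := by positivity
  have hAa : A ^ a = 2 * (R + 1) := by
    rw [hA, ← rpow_mul (by positivity), inv_mul_cancel₀ ha.ne', rpow_one]
  have hg : Summable fun k : ℕ => (A ^ (b - 1) * rexp (-A))⁻¹ * (1 / 2 : ℝ) ^ k :=
    (summable_geometric_of_lt_one (by norm_num) (by norm_num)).mul_left _
  refine hg.of_norm_bounded_eventually_nat ?_
  have hev : ∀ᶠ k : ℕ in atTop, 1 ≤ (k : ℝ) * a + b := by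
    filter_upwards [(tendsto_natCast_atTop_atTop.atTop_mul_const ha).eventually_ge_atTop 1] with k hk
    linarith
  filter_upwards [hev] with k hk
  have hG := rpow_mul_exp_neg_le_Gamma hA0 hk
  have e : A ^ ((k : ℝ) * a + b - 1) = (2 * (R + 1)) ^ k * A ^ (b - 1) := by
    rw [add_sub_assoc, rpow_add hA0, mul_comm (k : ℝ) a, rpow_mul hA0.le, hAa, rpow_natCast]
  rw [e] at hG
  have hGp : 0 < Real.Gamma ((k : ℝ) * a + b) := Real.Gamma_pos_of_pos (by linarith)
  rw [norm_of_nonneg (by positivity), div_le_iff₀ hGp]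
  calc R ^ k ≤ (R + 1) ^ k := by gcongr; linarith
    _ = (A ^ (b - 1) * rexp (-A))⁻¹ * (1 / 2 : ℝ) ^ k *
        ((2 * (R + 1)) ^ k * A ^ (b - 1) * rexp (-A)) := by
      rw [mul_pow, one_div, inv_pow]
      field_simp
    _ ≤ _ := by gcongr

theorem summable_norm_complexML {a b : ℝ} (ha : 0 < a) (hb : 0 < b) (z : ℂ) :
    Summable fun k : ℕ => ‖z ^ k / (Real.Gamma ((k : ℝ) * a + b) : ℂ)‖ := by
  refine (summable_pow_div_Gamma ha hb (norm_nonneg z)).congr fun k => ?_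
  rw [norm_div, norm_pow, Complex.norm_real,
    norm_of_nonneg (Real.Gamma_pos_of_pos (by positivity)).le]

theorem differentiable_complexML {a b : ℝ} (ha : 0 < a) (hb : 0 < b) :
    Differentiable ℂ (complexML a b) := by
  intro z
  refine DifferentiableOn.differentiableAt (s := Metric.ball 0 (‖z‖ + 1)) ?_
    (Metric.isOpen_ball.mem_nhds (by simp))
  refine Complex.differentiableOn_tsum_of_summable_norm
    (summable_pow_div_Gamma ha hb (by positivity : 0 ≤ ‖z‖ + 1)) (fun k => by fun_prop)
    Metric.isOpen_ball fun k w hw => ?_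
  have hw : ‖w‖ < ‖z‖ + 1 := by simpa using hw
  have hG : 0 < Real.Gamma ((k : ℝ) * a + b) := Real.Gamma_pos_of_pos (by positivity)
  rw [norm_div, norm_pow, Complex.norm_real, norm_of_nonneg hG.le]
  gcongr

theorem summable_ML {a b : ℝ} (ha : 0 < a) (hb : 0 < b) (x : ℝ) :
    Summable fun k : ℕ => x ^ k / Real.Gamma ((k : ℝ) * a + b) := by
  refine Summable.of_norm ((summable_norm_complexML ha hb (x : ℂ)).congr fun k => ?_)
  rw [← Complex.norm_real]
  push_cast
  rfl

theorem continuous_ML {a b : ℝ} (ha : 0 < a) (hb : 0 < b) : Continuous (ML a b) := by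
  have h : Continuous fun x : ℝ => (complexML a b (x : ℂ)).re :=
    Complex.continuous_re.comp
      ((differentiable_complexML ha hb).continuous.comp Complex.continuous_ofReal)
  simpa only [complexML_ofReal, Complex.ofReal_re] using h

theorem ML_eq_one_div_Gamma_add {a b : ℝ} (ha : 0 < a) (hb : 0 < b) (x : ℝ) :
    ML a b x = 1 / Real.Gamma b + x * ML a (b + a) x := by
  rw [ML, (summable_ML ha hb x).tsum_eq_zero_add, ML, ← tsum_mul_left]
  congr 1
  · simp
  · congr 1 with k
    push_cast
    rw [pow_succ', mul_div_assoc, show ((k : ℝ) + 1) * a + b = k * a + (b + a) by ring]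

theorem vline_cpow_neg_re_nonneg {a : ℝ} (ha0 : 0 ≤ a) (ha1 : a ≤ 1) (w : ℝ) :
    0 ≤ (vline w ^ (-a : ℂ)).re := by
  have harg : |(vline w).arg| < π / 2 := Complex.abs_arg_lt_pi_div_two_iff.mpr (Or.inl (by simp))
  rw [show (-a : ℂ) = ((-a : ℝ) : ℂ) by push_cast; rfl, Complex.cpow_ofReal_re]
  refine mul_nonneg (by positivity) (Real.cos_nonneg_of_mem_Icc (abs_le.mp ?_))
  rw [abs_mul, abs_neg, abs_of_nonneg ha0]
  nlinarith [abs_nonneg (vline w).arg]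

theorem norm_vline_cpow_neg_le_one {a : ℝ} (ha0 : 0 ≤ a) (w : ℝ) :
    ‖vline w ^ (-a : ℂ)‖ ≤ 1 := by
  rw [show (-a : ℂ) = ((-a : ℝ) : ℂ) by push_cast; rfl, Complex.norm_cpow_real]
  exact rpow_le_one_of_one_le_of_nonpos (one_le_norm_vline w) (by linarith)

theorem integrable_cexp_mul_vline_cpow {s : ℝ} (hs : 0 < s) :
    Integrable fun w : ℝ => Complex.exp (vline w) * vline w ^ (-(s + 1) : ℂ) := by
  refine (integrable_vline_cpow hs).bdd_mul (c := rexp 1)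
    (Continuous.aestronglyMeasurable (by fun_prop)) (Eventually.of_forall fun w => ?_)
  rw [Complex.norm_exp, vline_re]

theorem hasSum_add_mul_geometric (a b : ℂ) {ξ : ℂ} (hξ : ‖ξ‖ < 1) :
    HasSum (fun k : ℕ => ((k : ℂ) * a + b) * ξ ^ k)
      ((b - a) * (1 - ξ)⁻¹ + a * ((1 - ξ)⁻¹) ^ 2) := by
  have h := ((hasSum_coe_mul_geometric_of_norm_lt_one hξ).mul_left a).add
    ((hasSum_geometric_of_norm_lt_one hξ).mul_left b)
  have hne : 1 - ξ ≠ 0 := fun h0 => by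
    rw [← sub_eq_zero.mp h0] at hξ
    simp at hξ
  convert! h using 1
  · ext k
    ring
  · field_simp
    ring

section Bromwich

variable (a b : ℝ)

/-- The integrand of the Bromwich representation of `z ↦ E_{a,b}(-z)`. -/
noncomputable def bromwichML (z : ℂ) (w : ℝ) : ℂ :=
  Complex.exp (vline w) * vline w ^ (-(b + 1) : ℂ) *
    (((b : ℂ) - a) * (1 + z * vline w ^ (-a : ℂ))⁻¹ +
      a * ((1 + z * vline w ^ (-a : ℂ))⁻¹) ^ 2)

/-- A convex neighbourhood of the nonnegative real axis. -/
def halfStrip : Set ℂ := {z | -(1 / 4) < z.re} ∩ ({z | -(1 / 4) < z.im} ∩ {z | z.im < 1 / 4})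

theorem isOpen_halfStrip : IsOpen halfStrip :=
  (isOpen_lt continuous_const Complex.continuous_re).inter
    ((isOpen_lt continuous_const Complex.continuous_im).inter
      (isOpen_lt Complex.continuous_im continuous_const))

theorem isPreconnected_halfStrip : IsPreconnected halfStrip :=
  ((convex_halfSpace_re_gt _).inter
    ((convex_halfSpace_im_gt _).inter (convex_halfSpace_im_lt _))).isPreconnected

theorem ofReal_mem_halfStrip {x : ℝ} (hx : 0 ≤ x) : (x : ℂ) ∈ halfStrip := by
  refine ⟨?_, ?_, ?_⟩ <;> simp
  linarith

variable {a b}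

theorem half_le_re_one_add_mul {z q : ℂ} (hz : z ∈ halfStrip) (hq : ‖q‖ ≤ 1) (hre : 0 ≤ q.re) :
    1 / 2 ≤ (1 + z * q).re := by
  obtain ⟨h1, h2, h3⟩ := hz
  simp only [Set.mem_ofPred_eq] at h1 h2 h3
  have hr := abs_le.mp ((Complex.abs_re_le_norm q).trans hq)
  have hi := abs_le.mp ((Complex.abs_im_le_norm q).trans hq)
  simp only [Complex.add_re, Complex.one_re, Complex.mul_re]
  have : |z.im * q.im| ≤ 1 / 4 := by
    rw [abs_mul]
    nlinarith [abs_le.mpr ⟨h2.le, h3.le⟩, abs_le.mpr hi, abs_nonneg z.im, abs_nonneg q.im]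
  nlinarith [(abs_le.mp this).2]

theorem one_add_mul_vline_ne_zero (ha0 : 0 ≤ a) (ha1 : a ≤ 1) {z : ℂ} (hz : z ∈ halfStrip)
    (w : ℝ) : 1 + z * vline w ^ (-a : ℂ) ≠ 0 := fun h => by
  have := half_le_re_one_add_mul hz (norm_vline_cpow_neg_le_one ha0 w)
    (vline_cpow_neg_re_nonneg ha0 ha1 w)
  rw [h] at this
  norm_num at this

theorem norm_inv_one_add_mul_vline_le (ha0 : 0 ≤ a) (ha1 : a ≤ 1) {z : ℂ} (hz : z ∈ halfStrip)
    (w : ℝ) : ‖(1 + z * vline w ^ (-a : ℂ))⁻¹‖ ≤ 2 := by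
  have h := (half_le_re_one_add_mul hz (norm_vline_cpow_neg_le_one ha0 w)
    (vline_cpow_neg_re_nonneg ha0 ha1 w)).trans (Complex.re_le_norm _)
  rw [norm_inv]
  exact (inv_anti₀ (by norm_num) h).trans (by norm_num)

theorem continuous_bromwichML (ha0 : 0 ≤ a) (ha1 : a ≤ 1) {z : ℂ} (hz : z ∈ halfStrip) :
    Continuous (bromwichML a b z) := by
  have h1 := continuous_vline_cpow (-a : ℂ)
  have h2 := continuous_vline_cpow (-(b + 1) : ℂ)
  have h3 : Continuous fun w => (1 + z * vline w ^ (-a : ℂ))⁻¹ :=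
    (continuous_const.add (continuous_const.mul h1)).inv₀ (one_add_mul_vline_ne_zero ha0 ha1 hz)
  unfold bromwichML
  fun_prop

theorem norm_bromwichML_le (ha0 : 0 ≤ a) (ha1 : a ≤ 1) {z : ℂ} (hz : z ∈ halfStrip) (w : ℝ) :
    ‖bromwichML a b z w‖ ≤
      ‖Complex.exp (vline w) * vline w ^ (-(b + 1) : ℂ)‖ * (‖(b : ℂ) - a‖ * 2 + ‖(a : ℂ)‖ * 2 ^ 2) := by
  have h := norm_inv_one_add_mul_vline_le ha0 ha1 hz w
  rw [bromwichML, norm_mul]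
  gcongr
  refine (norm_add_le _ _).trans ?_
  rw [norm_mul, norm_mul, norm_pow]
  gcongr

theorem integrable_bromwichML (ha0 : 0 ≤ a) (ha1 : a ≤ 1) (hb : 0 < b) {z : ℂ}
    (hz : z ∈ halfStrip) : Integrable (bromwichML a b z) :=
  ((integrable_cexp_mul_vline_cpow hb).norm.mul_const _).mono'
    (continuous_bromwichML ha0 ha1 hz).aestronglyMeasurable
    (Eventually.of_forall (norm_bromwichML_le ha0 ha1 hz))

theorem differentiableOn_integral_bromwichML (ha0 : 0 ≤ a) (ha1 : a ≤ 1) (hb : 0 < b) :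
    DifferentiableOn ℂ (fun z => ∫ w, bromwichML a b z w) halfStrip := by
  intro z hz
  refine DifferentiableAt.differentiableWithinAt ?_
  refine HasDerivAt.differentiableAt (hasDerivAt_integral_of_dominated_loc_of_deriv_le
    (F := bromwichML a b) (s := halfStrip)
    (F' := fun z w => Complex.exp (vline w) * vline w ^ (-(b + 1) : ℂ) *
      (((b : ℂ) - a) * (-vline w ^ (-a : ℂ) * ((1 + z * vline w ^ (-a : ℂ))⁻¹) ^ 2) +
        a * (2 * (1 + z * vline w ^ (-a : ℂ))⁻¹ *
          (-vline w ^ (-a : ℂ) * ((1 + z * vline w ^ (-a : ℂ))⁻¹) ^ 2))))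
    (bound := fun w => ‖Complex.exp (vline w) * vline w ^ (-(b + 1) : ℂ)‖ *
      (‖(b : ℂ) - a‖ * (1 * 2 ^ 2) + ‖(a : ℂ)‖ * (2 * 2 * (1 * 2 ^ 2))))
    (isOpen_halfStrip.mem_nhds hz) ?_ (integrable_bromwichML ha0 ha1 hb hz) ?_ ?_
    ((integrable_cexp_mul_vline_cpow hb).norm.mul_const _) ?_).2
  · filter_upwards [isOpen_halfStrip.mem_nhds hz] with y hy
    exact (continuous_bromwichML ha0 ha1 hy).aestronglyMeasurable
  · have h1 := continuous_vline_cpow (-a : ℂ)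
    have h2 := continuous_vline_cpow (-(b + 1) : ℂ)
    have h3 : Continuous fun w => (1 + z * vline w ^ (-a : ℂ))⁻¹ :=
      (continuous_const.add (continuous_const.mul h1)).inv₀ (one_add_mul_vline_ne_zero ha0 ha1 hz)
    exact Continuous.aestronglyMeasurable (by fun_prop)
  · refine Eventually.of_forall fun w y hy => ?_
    have h := norm_inv_one_add_mul_vline_le ha0 ha1 hy w
    have hq := norm_vline_cpow_neg_le_one ha0 w
    rw [norm_mul]
    gcongr
    refine (norm_add_le _ _).trans ?_
    simp only [norm_mul, norm_pow, norm_neg, Complex.norm_ofNat]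
    gcongr
  · refine Eventually.of_forall fun w y hy => ?_
    have hne := one_add_mul_vline_ne_zero ha0 ha1 hy w
    have hv : HasDerivAt (fun y : ℂ => (1 + y * vline w ^ (-a : ℂ))⁻¹)
        (-vline w ^ (-a : ℂ) * ((1 + y * vline w ^ (-a : ℂ))⁻¹) ^ 2) y := by
      convert! (((hasDerivAt_id y).mul_const (vline w ^ (-a : ℂ))).const_add 1).inv hne using 1
      simp [div_eq_mul_inv]
    convert! ((hv.const_mul ((b : ℂ) - a)).add ((hv.pow 2).const_mul (a : ℂ))).const_mul
      (Complex.exp (vline w) * vline w ^ (-(b + 1) : ℂ)) using 1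
    simp

theorem complexML_neg_eq_integral_of_norm_lt (ha0 : 0 < a) (hb : 0 < b) {z : ℂ}
    (hz : ‖z‖ < 1) : complexML a b (-z) = ∫ w, bromwichML a b z w := by
  have hbk : ∀ k : ℕ, 0 < (k : ℝ) * a + b := fun k => by positivity
  set F : ℕ → ℝ → ℂ := fun k w => Complex.exp (vline w) * vline w ^ (-(b + 1) : ℂ) *
    (((k : ℂ) * a + b) * (-z * vline w ^ (-a : ℂ)) ^ k) with hF
  have hF' : ∀ k w, F k w = ((k : ℂ) * a + b) * (-z) ^ k *
      (Complex.exp (vline w) * vline w ^ (-(((k : ℝ) * a + b : ℝ) + 1) : ℂ)) := by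
    intro k w
    have e : (-(((k : ℝ) * a + b : ℝ) + 1) : ℂ) = -(b + 1) + (k : ℂ) * (-a) := by
      push_cast
      ring
    rw [e, Complex.cpow_add _ _ (vline_ne_zero w), Complex.cpow_nat_mul]
    simp only [hF]
    ring
  have hterm : ∀ k, ∫ w, F k w = (-z) ^ k / (Real.Gamma ((k : ℝ) * a + b) : ℂ) := by
    intro k
    simp_rw [hF']
    rw [integral_const_mul, integral_cexp_mul_vline_cpow (hbk k), Real.Gamma_add_one (hbk k).ne']
    have h1 : ((k : ℂ) * a + b) ≠ 0 := by exact_mod_cast (hbk k).ne'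
    have h2 : (Real.Gamma ((k : ℝ) * a + b) : ℂ) ≠ 0 :=
      Complex.ofReal_ne_zero.mpr (Real.Gamma_pos_of_pos (hbk k)).ne'
    push_cast
    field_simp
  have hint : ∀ k, Integrable (F k) := by
    intro k
    rw [funext (hF' k)]
    exact (integrable_cexp_mul_vline_cpow (hbk k)).const_mul _
  have hsum : Summable fun k => ∫ w, ‖F k w‖ := by
    have hgeo : Summable fun k : ℕ => ((k : ℝ) * a + b) * ‖z‖ ^ k := by
      have h1 := (summable_pow_mul_geometric_of_norm_lt_one 1 (r := ‖z‖) (by simpa using hz)).mul_left a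
      have h2 := (summable_geometric_of_lt_one (norm_nonneg z) hz).mul_left b
      refine (h1.add h2).congr fun k => ?_
      ring
    refine Summable.of_nonneg_of_le (fun k => integral_nonneg fun w => norm_nonneg _) (fun k => ?_)
      (hgeo.mul_left (∫ w, ‖Complex.exp (vline w) * vline w ^ (-(b + 1) : ℂ)‖))
    rw [← integral_mul_const]
    refine integral_mono (hint k).norm
      ((integrable_cexp_mul_vline_cpow hb).norm.mul_const _) fun w => ?_
    simp only [hF]
    rw [norm_mul, norm_mul ((k : ℂ) * a + b), norm_pow, norm_mul (-z), norm_neg]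
    have e : ‖(k : ℂ) * a + b‖ = (k : ℝ) * a + b := by
      rw [← norm_of_nonneg (hbk k).le, ← Complex.norm_real]
      push_cast
      rfl
    rw [e]
    have hq := norm_vline_cpow_neg_le_one ha0.le w
    have := hbk k
    gcongr
    exact mul_le_of_le_one_right (norm_nonneg z) hq
  have h := (hasSum_integral_of_summable_integral_norm hint hsum).tsum_eq
  simp_rw [hterm] at h
  rw [complexML, h]
  congr 1 with w
  have hξ : ‖-z * vline w ^ (-a : ℂ)‖ < 1 := by
    rw [norm_mul, norm_neg]
    exact (mul_le_of_le_one_right (norm_nonneg z) (norm_vline_cpow_neg_le_one ha0.le w)).trans_lt hz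
  simp only [hF]
  rw [tsum_mul_left, (hasSum_add_mul_geometric (a : ℂ) b hξ).tsum_eq, bromwichML]
  simp [sub_eq_add_neg]

theorem complexML_neg_eq_integral (ha0 : 0 < a) (ha1 : a ≤ 1) (hb : 0 < b) {z : ℂ}
    (hz : z ∈ halfStrip) : complexML a b (-z) = ∫ w, bromwichML a b z w := by
  refine AnalyticOnNhd.eqOn_of_preconnected_of_eventuallyEq
    (f := fun z => complexML a b (-z)) (g := fun z => ∫ w, bromwichML a b z w)
    (DifferentiableOn.analyticOnNhd
      ((differentiable_complexML ha0 hb).comp differentiable_neg).differentiableOn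
      isOpen_halfStrip)
    ((differentiableOn_integral_bromwichML ha0.le ha1 hb).analyticOnNhd isOpen_halfStrip)
    isPreconnected_halfStrip (z₀ := 0) (by simpa using ofReal_mem_halfStrip le_rfl) ?_ hz
  filter_upwards [Metric.ball_mem_nhds (0 : ℂ) one_pos] with y hy
  exact complexML_neg_eq_integral_of_norm_lt ha0 hb (by simpa using hy)

/-- Mittag-Leffler functions of order at most one tend to zero along the negative axis. -/
theorem tendsto_ML_neg_atTop (ha0 : 0 < a) (ha1 : a ≤ 1) (hb : 0 < b) :
    Tendsto (fun x : ℝ => ML a b (-x)) atTop (𝓝 0) := by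
  have hlim : Tendsto (fun x : ℝ => ∫ w, bromwichML a b (x : ℂ) w) atTop (𝓝 (∫ _ : ℝ, (0 : ℂ))) := by
    refine tendsto_integral_filter_of_dominated_convergence _ ?_ ?_
      ((integrable_cexp_mul_vline_cpow hb).norm.mul_const (‖(b : ℂ) - a‖ * 2 + ‖(a : ℂ)‖ * 2 ^ 2)) ?_
    · filter_upwards [eventually_ge_atTop 0] with x hx
      exact (continuous_bromwichML ha0.le ha1 (ofReal_mem_halfStrip hx)).aestronglyMeasurable
    · filter_upwards [eventually_ge_atTop 0] with x hx
      exact Eventually.of_forall (norm_bromwichML_le ha0.le ha1 (ofReal_mem_halfStrip hx))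
    · refine Eventually.of_forall fun w => ?_
      have hq : 0 < ‖vline w ^ (-a : ℂ)‖ :=
        norm_pos_iff.mpr (by simp [Complex.cpow_eq_zero_iff, vline_ne_zero])
      have hv : Tendsto (fun x : ℝ => (1 + (x : ℂ) * vline w ^ (-a : ℂ))⁻¹) atTop (𝓝 0) := by
        refine tendsto_inv₀_cobounded.comp (tendsto_norm_atTop_iff_cobounded.mp ?_)
        refine tendsto_atTop_mono (fun x => ?_)
          (tendsto_atTop_add_const_right _ (-1) (tendsto_id.atTop_mul_const hq))
        have h := norm_sub_le (1 + (x : ℂ) * vline w ^ (-a : ℂ)) 1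
        rw [add_sub_cancel_left, norm_mul, Complex.norm_real, norm_one] at h
        have := mul_le_mul_of_nonneg_right (le_norm_self x) hq.le
        simp only [id]
        linarith
      have := ((hv.const_mul ((b : ℂ) - a)).add ((hv.pow 2).const_mul (a : ℂ))).const_mul
        (Complex.exp (vline w) * vline w ^ (-(b + 1) : ℂ))
      simpa [bromwichML] using this
  rw [integral_zero] at hlim
  have h := (Complex.continuous_re.tendsto 0).comp hlim
  refine Tendsto.congr' ?_ (by simpa using h)
  filter_upwards [eventually_ge_atTop 0] with x hx
  rw [Function.comp_apply, ← complexML_neg_eq_integral ha0 ha1 hb (ofReal_mem_halfStrip hx),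
    ← Complex.ofReal_neg, complexML_ofReal, Complex.ofReal_re]

end Bromwich

theorem tendsto_mul_ML_neg_atTop {a b : ℝ} (ha0 : 0 < a) (ha1 : a ≤ 1) (hb : 0 < b) :
    Tendsto (fun x : ℝ => x * ML a (b + a) (-x)) atTop (𝓝 (Real.Gamma b)⁻¹) := by
  have h := (tendsto_ML_neg_atTop ha0 ha1 hb).const_sub (Real.Gamma b)⁻¹
  rw [sub_zero] at h
  refine h.congr fun x => ?_
  rw [ML_eq_one_div_Gamma_add ha0 hb]
  ring

theorem exists_abs_mul_ML_neg_le {a b : ℝ} (ha0 : 0 < a) (ha1 : a ≤ 1) (hb : 0 < b) :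
    ∃ M, ∀ x, 0 ≤ x → |x * ML a (b + a) (-x)| ≤ M := by
  have hc : Continuous fun x : ℝ => x * ML a (b + a) (-x) :=
    continuous_id.mul ((continuous_ML ha0 (by positivity)).comp continuous_neg)
  have hev := (tendsto_mul_ML_neg_atTop ha0 ha1 hb).abs.eventually_le_const
    (lt_add_one |(Real.Gamma b)⁻¹|)
  obtain ⟨X, hX⟩ := eventually_atTop.mp hev
  obtain ⟨K, hK⟩ := isCompact_Icc.exists_bound_of_continuousOn (s := Set.Icc 0 X) hc.continuousOn
  refine ⟨max K (|(Real.Gamma b)⁻¹| + 1), fun x hx => ?_⟩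
  rcases le_total X x with h | h
  · exact (hX x h).trans (le_max_right _ _)
  · exact (hK x ⟨hx, h⟩).trans (le_max_left _ _)

theorem integral_rpow_mul_one_sub_rpow {u v : ℝ} (hu : 0 < u) (hv : 0 < v) :
    ∫ x in (0 : ℝ)..1, x ^ (u - 1) * (1 - x) ^ (v - 1) =
      Real.Gamma u * Real.Gamma v / Real.Gamma (u + v) := by
  have h := Complex.betaIntegral_eq_Gamma_mul_div (u : ℂ) v (by simpa using hu) (by simpa using hv)
  rw [← Complex.ofReal_add, Complex.Gamma_ofReal, Complex.Gamma_ofReal, Complex.Gamma_ofReal] at h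
  have e : Complex.betaIntegral u v =
      ((∫ x in (0 : ℝ)..1, x ^ (u - 1) * (1 - x) ^ (v - 1) : ℝ) : ℂ) := by
    rw [Complex.betaIntegral, ← intervalIntegral.integral_ofReal]
    refine intervalIntegral.integral_congr fun x hx => ?_
    rw [Set.uIcc_of_le zero_le_one] at hx
    rw [Complex.ofReal_mul, Complex.ofReal_cpow hx.1, Complex.ofReal_cpow (by linarith [hx.2])]
    push_cast
    rfl
  rw [e] at h
  exact_mod_cast h

section Renewal

variable {a1 a2 C1 C2 : ℝ}

theorem Ufun_eq_rpow_mul (ha2 : 0 < a2) (ha12 : a2 < a1) (hC1 : 0 < C1) (hC2 : 0 < C2)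
    {t : ℝ} (ht : 0 ≤ t) :
    Ufun a1 a2 C1 C2 t = t ^ a2 / C2 * (C2 / C1 * t ^ (a1 - a2) *
      ML (a1 - a2) (a2 + 1 + (a1 - a2)) (-(C2 / C1 * t ^ (a1 - a2)))) := by
  rcases ht.eq_or_lt with rfl | ht
  · simp [Ufun, zero_rpow ha2.ne', zero_rpow (ha2.trans ha12).ne']
  · have e : t ^ a1 = t ^ a2 * t ^ (a1 - a2) := by rw [← rpow_add ht]; ring_nf
    rw [Ufun, show a2 + 1 + (a1 - a2) = a1 + 1 by ring,
      show -C2 * t ^ (a1 - a2) / C1 = -(C2 / C1 * t ^ (a1 - a2)) by ring, e]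
    field_simp

theorem ufun_eq_rpow_mul (ha12 : a2 < a1) (ha1 : a1 < 1) (hC1 : 0 < C1)
    (hC2 : 0 < C2) {t : ℝ} (ht : 0 ≤ t) :
    ufun a1 a2 C1 C2 t = t ^ (a2 - 1) / C2 * (C2 / C1 * t ^ (a1 - a2) *
      ML (a1 - a2) (a2 + (a1 - a2)) (-(C2 / C1 * t ^ (a1 - a2)))) := by
  rcases ht.eq_or_lt with rfl | ht
  · simp [ufun, zero_rpow (sub_neg.mpr ha1).ne, zero_rpow (sub_neg.mpr (ha12.trans ha1)).ne]
  · have e : t ^ (a1 - 1) = t ^ (a2 - 1) * t ^ (a1 - a2) := by rw [← rpow_add ht]; ring_nf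
    rw [ufun, show a2 + (a1 - a2) = a1 by ring,
      show -C2 * t ^ (a1 - a2) / C1 = -(C2 / C1 * t ^ (a1 - a2)) by ring, e]
    field_simp

theorem VarY_eq_two_mul_Ifun_sub (t : ℝ) :
    VarY a1 a2 C1 C2 t = 2 * Ifun a1 a2 C1 C2 t t - Ufun a1 a2 C1 C2 t ^ 2 := by
  rw [VarY, CovY, Ifun, min_self, ← intervalIntegral.integral_const_mul, sq]
  congr 2 with τ
  ring

theorem tendsto_rpow_neg_mul_Ufun (ha2 : 0 < a2) (ha12 : a2 < a1) (ha1 : a1 < 1) (hC1 : 0 < C1)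
    (hC2 : 0 < C2) :
    Tendsto (fun t => t ^ (-a2) * Ufun a1 a2 C1 C2 t) atTop
      (𝓝 (1 / C2 * (Real.Gamma (a2 + 1))⁻¹)) := by
  have hx : Tendsto (fun t : ℝ => C2 / C1 * t ^ (a1 - a2)) atTop atTop :=
    (tendsto_rpow_atTop (sub_pos.mpr ha12)).const_mul_atTop (div_pos hC2 hC1)
  have h := ((tendsto_mul_ML_neg_atTop (sub_pos.mpr ha12) (by linarith)
    (by linarith : 0 < a2 + 1)).comp hx).const_mul (1 / C2)
  refine h.congr' ?_
  filter_upwards [eventually_gt_atTop 0] with t ht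
  rw [Ufun_eq_rpow_mul ha2 ha12 hC1 hC2 ht.le, rpow_neg ht.le]
  have : 0 < t ^ a2 := by positivity
  simp only [Function.comp_apply]
  field_simp

theorem tendsto_rpow_neg_mul_Ifun (ha2 : 0 < a2) (ha12 : a2 < a1) (ha1 : a1 < 1) (hC1 : 0 < C1)
    (hC2 : 0 < C2) :
    Tendsto (fun t => t ^ (-(2 * a2)) * Ifun a1 a2 C1 C2 t t) atTop
      (𝓝 (1 / C2 ^ 2 * (Real.Gamma (2 * a2 + 1))⁻¹)) := by
  have hα : 0 < a1 - a2 := sub_pos.mpr ha12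
  have hα1 : a1 - a2 ≤ 1 := by linarith
  have ha2' : 0 < a2 + 1 := by linarith
  have hc : 0 < C2 / C1 := div_pos hC2 hC1
  set P : ℝ → ℝ := fun x => x * ML (a1 - a2) (a2 + 1 + (a1 - a2)) (-x) with hP
  set Q : ℝ → ℝ := fun x => x * ML (a1 - a2) (a2 + (a1 - a2)) (-x) with hQ
  have hPc : Continuous P :=
    continuous_id.mul ((continuous_ML hα (by positivity)).comp continuous_neg)
  have hQc : Continuous Q :=
    continuous_id.mul ((continuous_ML hα (by positivity)).comp continuous_neg)
  obtain ⟨M, hM⟩ := exists_abs_mul_ML_neg_le hα hα1 ha2'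
  obtain ⟨N, hN⟩ := exists_abs_mul_ML_neg_le hα hα1 ha2
  have hM0 : 0 ≤ M := (abs_nonneg _).trans (hM 0 le_rfl)
  have hN0 : 0 ≤ N := (abs_nonneg _).trans (hN 0 le_rfl)
  have hscale : ∀ y : ℝ, 0 < y →
      Tendsto (fun t : ℝ => C2 / C1 * (t * y) ^ (a1 - a2)) atTop atTop := fun y hy =>
    ((tendsto_rpow_atTop hα).comp (tendsto_id.atTop_mul_const hy)).const_mul_atTop hc
  set F : ℝ → ℝ → ℝ := fun t x => x ^ (a2 - 1) * (1 - x) ^ a2 *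
    (P (C2 / C1 * (t * (1 - x)) ^ (a1 - a2)) * Q (C2 / C1 * (t * x) ^ (a1 - a2))) with hF
  have hlim : Tendsto (fun t => ∫ x in (0 : ℝ)..1, F t x) atTop
      (𝓝 (∫ x in (0 : ℝ)..1, x ^ (a2 - 1) * (1 - x) ^ a2 *
        ((Real.Gamma (a2 + 1))⁻¹ * (Real.Gamma a2)⁻¹))) := by
    refine intervalIntegral.tendsto_integral_filter_of_dominated_convergence
      (fun x => x ^ (a2 - 1) * (M * N)) ?_ ?_
      ((intervalIntegral.intervalIntegrable_rpow' (by linarith)).mul_const _) ?_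
    · refine Eventually.of_forall fun t => Measurable.aestronglyMeasurable ?_
      exact Measurable.mul (by fun_prop)
        ((hPc.measurable.comp (by fun_prop)).mul (hQc.measurable.comp (by fun_prop)))
    · filter_upwards [eventually_ge_atTop 0] with t ht
      refine Eventually.of_forall fun x hx => ?_
      rw [Set.uIoc_of_le zero_le_one] at hx
      have hx0 := hx.1
      have hx1 : 0 ≤ 1 - x := by linarith [hx.2]
      have h1 : (1 - x) ^ a2 ≤ 1 := rpow_le_one hx1 (by linarith) ha2.le
      have h2 := hM (C2 / C1 * (t * (1 - x)) ^ (a1 - a2)) (by positivity)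
      have h3 := hN (C2 / C1 * (t * x) ^ (a1 - a2)) (by positivity)
      rw [norm_mul, norm_mul (P _), norm_of_nonneg (by positivity)]
      have h4 : x ^ (a2 - 1) * (1 - x) ^ a2 ≤ x ^ (a2 - 1) :=
        mul_le_of_le_one_right (by positivity) h1
      exact mul_le_mul h4 (mul_le_mul h2 h3 (norm_nonneg _) hM0)
        (by positivity) (by positivity)
    · have hne : ∀ᵐ x : ℝ, x ≠ 1 := by simp [ae_iff]
      filter_upwards [hne] with x hx1 hx
      rw [Set.uIoc_of_le zero_le_one] at hx
      have hx' : 0 < 1 - x := sub_pos.mpr (lt_of_le_of_ne hx.2 hx1)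
      exact (((tendsto_mul_ML_neg_atTop hα hα1 ha2').comp (hscale _ hx')).mul
        ((tendsto_mul_ML_neg_atTop hα hα1 ha2).comp (hscale _ hx.1))).const_mul _
  have hval : ∫ x in (0 : ℝ)..1, x ^ (a2 - 1) * (1 - x) ^ a2 *
      ((Real.Gamma (a2 + 1))⁻¹ * (Real.Gamma a2)⁻¹) = (Real.Gamma (2 * a2 + 1))⁻¹ := by
    have h := integral_rpow_mul_one_sub_rpow ha2 ha2'
    rw [add_sub_cancel_right, show a2 + (a2 + 1) = 2 * a2 + 1 by ring] at h
    rw [intervalIntegral.integral_mul_const, h]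
    have h1 := (Real.Gamma_pos_of_pos ha2).ne'
    have h2 := (Real.Gamma_pos_of_pos ha2').ne'
    field_simp
  rw [hval] at hlim
  refine (hlim.const_mul (1 / C2 ^ 2)).congr' ?_
  filter_upwards [eventually_gt_atTop 0] with t ht
  have hsub := intervalIntegral.mul_integral_comp_mul_left (a := 0) (b := 1)
    (f := fun τ => Ufun a1 a2 C1 C2 (t - τ) * ufun a1 a2 C1 C2 τ) t
  rw [mul_zero, mul_one] at hsub
  rw [Ifun, ← hsub, ← intervalIntegral.integral_const_mul, ← intervalIntegral.integral_const_mul,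
    ← intervalIntegral.integral_const_mul]
  refine intervalIntegral.integral_congr fun x hx => ?_
  rw [Set.uIcc_of_le zero_le_one] at hx
  have hx0 := hx.1
  have hx1 : 0 ≤ 1 - x := by linarith [hx.2]
  rw [show t - t * x = t * (1 - x) by ring,
    Ufun_eq_rpow_mul ha2 ha12 hC1 hC2 (mul_nonneg ht.le hx1),
    ufun_eq_rpow_mul ha12 ha1 hC1 hC2 (mul_nonneg ht.le hx0)]
  change 1 / C2 ^ 2 * F t x = t ^ (-(2 * a2)) * (t *
    ((t * (1 - x)) ^ a2 / C2 * P (C2 / C1 * (t * (1 - x)) ^ (a1 - a2)) *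
      ((t * x) ^ (a2 - 1) / C2 * Q (C2 / C1 * (t * x) ^ (a1 - a2)))))
  have e : t ^ (-(2 * a2)) * (t * (t ^ a2 * t ^ (a2 - 1))) = 1 := by
    nth_rewrite 2 [← rpow_one t]
    rw [← rpow_add ht, ← rpow_add ht, ← rpow_add ht, ← rpow_zero t]
    ring_nf
  rw [mul_rpow (z := a2) ht.le hx1, mul_rpow (z := a2 - 1) ht.le hx0]
  simp only [hF]
  linear_combination (-(1 / C2 ^ 2 * (x ^ (a2 - 1) * (1 - x) ^ a2 *
    (P (C2 / C1 * (t * (1 - x)) ^ (a1 - a2)) * Q (C2 / C1 * (t * x) ^ (a1 - a2)))))) * e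

end Renewal

/-- For fixed `λ > 0`, the variance of the mixed fractional Poisson process satisfies
`t^{-2α₂} Var_N(t) → (λ²/C₂²)(2/Γ(2α₂+1) - 1/Γ(α₂+1)²)` as `t → ∞`. -/
theorem stmt_17 (a1 a2 C1 C2 : ℝ) (ha2 : 0 < a2) (ha12 : a2 < a1) (ha1 : a1 < 1)
    (hC1 : 0 < C1) (hC2 : 0 < C2) (hC : C1 + C2 = 1) (lam : ℝ) (hlam : 0 < lam) :
    Tendsto (fun t : ℝ => t ^ (-(2 * a2)) * VarN a1 a2 C1 C2 lam t) atTop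
      (𝓝 (lam ^ 2 / C2 ^ 2
        * (2 / Real.Gamma (2 * a2 + 1) - 1 / Real.Gamma (a2 + 1) ^ 2))) := by
  have hU := tendsto_rpow_neg_mul_Ufun ha2 ha12 ha1 hC1 hC2
  have hI := tendsto_rpow_neg_mul_Ifun ha2 ha12 ha1 hC1 hC2
  have h := (((tendsto_rpow_neg_atTop ha2).mul hU).const_mul lam).add
    (((hI.const_mul 2).sub (hU.pow 2)).const_mul (lam ^ 2))
  rw [show lam * (0 * (1 / C2 * (Real.Gamma (a2 + 1))⁻¹)) + lam ^ 2 *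
      (2 * (1 / C2 ^ 2 * (Real.Gamma (2 * a2 + 1))⁻¹) - (1 / C2 * (Real.Gamma (a2 + 1))⁻¹) ^ 2) =
    lam ^ 2 / C2 ^ 2 * (2 / Real.Gamma (2 * a2 + 1) - 1 / Real.Gamma (a2 + 1) ^ 2) by ring] at h
  refine h.congr' ?_
  filter_upwards [eventually_gt_atTop 0] with t ht
  have e : t ^ (-(2 * a2)) = t ^ (-a2) * t ^ (-a2) := by
    rw [← rpow_add ht]
    ring_nf
  rw [VarN, VarY_eq_two_mul_Ifun_sub, e]
  ring
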